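/- Let d ≥ 2 be an integer, γ ∈ (1/2,(d+2)/4), and C̄_{d,γ} = (2/√π)·Γ(2γ−1)Γ((d+1)/2 − γ)² / (Γ((d−1)/2)·Γ((d+2−4γ)/2)·Γ((2γ−1)/2)²). Let △ = {(φ₁,φ₂) : φ₁ ≥ 0, φ₂ ≥ 0, φ₁ + φ₂ ≤ π}. Then for every ξ ∈ ℝ^d \ {0} and every bounded measurable k : △ → ℝ, ∫_{ℝ^d} k(θ(ξ,η), θ(ξ,ξ−η)) H(η|ξ) dη = C̄_{d,γ} ∫_△ k(φ₁,φ₂) (sin φ₁ · sin φ₂)^{2γ−2} sin^{d+1−4γ}(φ₁+φ₂) dφ₁ dφ₂, where θ(u,v) ∈ [0,π] is the Euclidean angle between nonzero vectors u, v. -/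

import Mathlib

open MeasureTheory Set Real

/-- The constant `c_{d,γ}` of the standard majorizing kernel. -/
noncomputable def cdg (d : ℕ) (γ : ℝ) : ℝ :=
  Real.pi ^ (-(d : ℝ)/2) * Real.Gamma (2*γ - 1) * (Real.Gamma (((d : ℝ) + 1 - 2*γ)/2))^2 /
    (Real.Gamma (((d : ℝ) + 2 - 4*γ)/2) * (Real.Gamma ((2*γ - 1)/2))^2)

/-- `H(η|ξ) = c_{d,γ} |η|^{2γ−d−1} |ξ−η|^{2γ−d−1} |ξ|^{d+2−4γ}`. -/
noncomputable def Hker (d : ℕ) (γ : ℝ) (η ξ : EuclideanSpace ℝ (Fin d)) : ℝ :=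
  cdg d γ * ‖η‖ ^ (2*γ - (d : ℝ) - 1) * ‖ξ - η‖ ^ (2*γ - (d : ℝ) - 1)
    * ‖ξ‖ ^ ((d : ℝ) + 2 - 4*γ)

/-- The constant `C̄_{d,γ}`. -/
noncomputable def Cbar (d : ℕ) (γ : ℝ) : ℝ :=
  2 / Real.sqrt Real.pi * Real.Gamma (2*γ - 1) * (Real.Gamma (((d : ℝ) + 1)/2 - γ))^2 /
    (Real.Gamma (((d : ℝ) - 1)/2) * Real.Gamma (((d : ℝ) + 2 - 4*γ)/2)
      * (Real.Gamma ((2*γ - 1)/2))^2)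

/-- The triangle `△ = {(φ₁,φ₂) : φ₁ ≥ 0, φ₂ ≥ 0, φ₁ + φ₂ ≤ π}`. -/
def triangleSet : Set (ℝ × ℝ) := {p | 0 ≤ p.1 ∧ 0 ≤ p.2 ∧ p.1 + p.2 ≤ Real.pi}


lemma aux_map_norm {E : Type*} [NormedAddCommGroup E] [NormedSpace ℝ E]
    [MeasurableSpace E] [Nontrivial E] (μ : Measure E) [FiniteDimensional ℝ E] [BorelSpace E]
    [μ.IsAddHaarMeasure] :
    Measure.map (fun x : E => ‖x‖) μ =
      ((Module.finrank ℝ E : ENNReal) * μ (Metric.ball 0 1)) •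
        (volume.restrict (Ioi (0:ℝ))).withDensity
          (fun r => ENNReal.ofReal (r ^ (Module.finrank ℝ E - 1))) := by
  ext s hs
  have hf : Measurable (s.indicator (1 : ℝ → ENNReal)) := measurable_one.indicator hs
  rw [← lintegral_indicator_one hs, ← lintegral_indicator_one hs,
    lintegral_map hf measurable_norm, lintegral_smul_measure,
    lintegral_withDensity_eq_lintegral_mul _ (by fun_prop) hf]
  generalize s.indicator (1 : ℝ → ENNReal) = f at hf
  calc
    ∫⁻ x, f (‖x‖) ∂μ = ∫⁻ x : ({(0)}ᶜ : Set E), f (‖x.1‖) ∂(μ.comap (↑)) := by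
      rw [lintegral_subtype_comap (measurableSet_singleton _).compl fun x ↦ f (‖x‖),
        restrict_compl_singleton]
    _ = ∫⁻ x, f x.2 ∂μ.toSphere.prod (.volumeIoiPow (Module.finrank ℝ E - 1)) := by
      simpa using μ.measurePreserving_homeomorphUnitSphereProd.lintegral_comp_emb
        (Homeomorph.measurableEmbedding _) (f ∘ Subtype.val ∘ Prod.snd)
    _ = μ.toSphere univ * ∫⁻ x : Ioi (0 : ℝ), f x ∂.volumeIoiPow (Module.finrank ℝ E - 1) := by
      rw [lintegral_prod _ (by fun_prop)]
      simp [mul_comm]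
    _ = _ := by
      simp only [Measure.volumeIoiPow]
      rw [lintegral_withDensity_eq_lintegral_mul _ (by fun_prop) (by fun_prop),
        Measure.toSphere_apply_univ, smul_eq_mul,
        ← lintegral_subtype_comap measurableSet_Ioi]
      rfl

lemma aux_decomp {E : Type*} [NormedAddCommGroup E] [InnerProductSpace ℝ E]
    [MeasurableSpace E] [BorelSpace E] [FiniteDimensional ℝ E] (n : ℕ)
    (hn : Module.finrank ℝ E = n + 2) (ξ : E) (hξ : ξ ≠ 0) :
    ∃ S : E → ℝ × ℝ, Measurable S ∧ (∀ η, 0 ≤ (S η).2) ∧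
      (∀ η, inner ℝ ξ η = ‖ξ‖ * (S η).1) ∧
      (∀ η, ‖η‖ ^ 2 = (S η).1 ^ 2 + (S η).2 ^ 2) ∧
      Measure.map S volume =
        ENNReal.ofReal ((n + 1 : ℕ) * (√π ^ (n + 1) / Real.Gamma ((n + 1 : ℕ) / 2 + 1))) •
        (volume.restrict (univ ×ˢ Ioi (0:ℝ)) : Measure (ℝ × ℝ)).withDensity
          (fun p => ENNReal.ofReal (p.2 ^ n)) := by
  have hL : ‖ξ‖ ≠ 0 := by simpa using hξ
  set e : E := ‖ξ‖⁻¹ • ξ with he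
  have hee : ‖e‖ = 1 := by simp [he, norm_smul, hL]
  have hξe : ξ = ‖ξ‖ • e := by simp [he, smul_smul, hL]
  let K : Submodule ℝ E := Submodule.span ℝ {e}
  let u : ℝ ≃ₗᵢ[ℝ] K := LinearIsometryEquiv.toSpanUnitSingleton e hee
  let T : E → ℝ × Kᗮ := fun η => (u.symm (K.orthogonalProjectionOnto η), Kᗮ.orthogonalProjectionOnto η)
  have hfin : Module.finrank ℝ Kᗮ = n + 1 := by
    have h1 := K.finrank_add_finrank_orthogonal
    have h2 : Module.finrank ℝ K = 1 := finrank_span_singleton (by rintro h; simp [h] at hee)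
    omega
  have : Nontrivial Kᗮ := Module.nontrivial_of_finrank_pos (R := ℝ) (by omega)
  have hT : MeasurePreserving T volume volume := by
    have h1 := K.orthogonalDecomposition.measurePreserving
    have h2 := WithLp.volume_preserving_ofLp K Kᗮ
    have h3 : MeasurePreserving (Prod.map u.symm (id : Kᗮ → Kᗮ)) (volume : Measure (K × Kᗮ)) (volume : Measure (ℝ × Kᗮ)) :=
      MeasurePreserving.prod u.symm.measurePreserving (MeasurePreserving.id _)
    have := h3.comp (h2.comp h1)
    have hTe : T = Prod.map u.symm (id : Kᗮ → Kᗮ) ∘ WithLp.ofLp ∘ K.orthogonalDecomposition := by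
      funext η
      simp [T]
    rw [hTe]
    exact this
  have hu : ∀ η, ((K.orthogonalProjectionOnto η : K) : E) = (T η).1 • e := by
    intro η
    have : u (T η).1 = K.orthogonalProjectionOnto η := by simp [T]
    rw [← this]; rfl
  refine ⟨Prod.map id norm ∘ T, (measurable_id.prodMap measurable_norm).comp hT.measurable, fun η => norm_nonneg _, ?_, ?_, ?_⟩
  · intro η
    have h1 : inner ℝ e η = (T η).1 := by
      have hmem : e ∈ K := Submodule.mem_span_singleton_self e
      have := K.inner_orthogonalProjectionOnto_eq_of_mem_left ⟨e, hmem⟩ η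
      simp only [Submodule.coe_inner] at this
      rw [← this, hu, inner_smul_right, real_inner_self_eq_norm_sq, hee]; simp
    rw [hξe, inner_smul_left, h1, ← hξe]; simp
  · intro η
    rw [K.norm_sq_eq_add_norm_sq_projection η]
    congr 1
    rw [Submodule.coe_norm, hu, norm_smul, hee]; simp
  · rw [← Measure.map_map (measurable_id.prodMap measurable_norm) hT.measurable, hT.map_eq,
      Measure.volume_eq_prod, ]
    have : SFinite (Measure.map (norm : Kᗮ → ℝ) volume) := inferInstance
    rw [← Measure.map_prod_map _ _ measurable_id measurable_norm]
    have := aux_map_norm (volume : Measure Kᗮ)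
    rw [this, InnerProductSpace.volume_ball, hfin, Measure.map_id, Measure.prod_smul_right,
      prod_withDensity_right (by fun_prop), Measure.volume_eq_prod ℝ ℝ, ← Measure.prod_restrict,
      Measure.restrict_univ]
    congr 1
    rw [ENNReal.ofReal_mul (by positivity), ENNReal.ofReal_natCast]
    simp

noncomputable def auxPhi (L : ℝ) (p : ℝ × ℝ) : ℝ × ℝ :=
  (L * (cos p.1 * sin p.2) / sin (p.1 + p.2), L * (sin p.1 * sin p.2) / sin (p.1 + p.2))

noncomputable def auxPsi (L : ℝ) (q : ℝ × ℝ) : ℝ × ℝ :=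
  (arccos (q.1 / √(q.1 ^ 2 + q.2 ^ 2)), arccos ((L - q.1) / √((L - q.1) ^ 2 + q.2 ^ 2)))

def auxTri : Set (ℝ × ℝ) := {p | 0 < p.1 ∧ 0 < p.2 ∧ p.1 + p.2 < π}

lemma auxTri_sin {p : ℝ × ℝ} (hp : p ∈ auxTri) :
    0 < sin p.1 ∧ 0 < sin p.2 ∧ 0 < sin (p.1 + p.2) := by
  obtain ⟨h1, h2, h3⟩ := hp
  exact ⟨sin_pos_of_pos_of_lt_pi h1 (by linarith), sin_pos_of_pos_of_lt_pi h2 (by linarith),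
    sin_pos_of_pos_of_lt_pi (by linarith) h3⟩

lemma auxTri_open : IsOpen auxTri := by
  have : auxTri = {p : ℝ × ℝ | 0 < p.1} ∩ ({p | 0 < p.2} ∩ {p | p.1 + p.2 < π}) := rfl
  rw [this]
  apply IsOpen.inter (isOpen_lt (by fun_prop) (by fun_prop))
  apply IsOpen.inter (isOpen_lt (by fun_prop) (by fun_prop)) (isOpen_lt (by fun_prop) (by fun_prop))

lemma auxPhi_sub {L : ℝ} {p : ℝ × ℝ} (hp : p ∈ auxTri) :
    L - (auxPhi L p).1 = L * (sin p.1 * cos p.2) / sin (p.1 + p.2) := by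
  have h := (auxTri_sin hp).2.2.ne'
  simp only [auxPhi]
  rw [eq_div_iff h, sub_mul, div_mul_cancel₀ _ h, sin_add]; ring

lemma auxPhi_n1 {L : ℝ} (hL : 0 < L) {p : ℝ × ℝ} (hp : p ∈ auxTri) :
    √((auxPhi L p).1 ^ 2 + (auxPhi L p).2 ^ 2) = L * sin p.2 / sin (p.1 + p.2) := by
  obtain ⟨h1, h2, h3⟩ := auxTri_sin hp
  rw [Real.sqrt_eq_iff_mul_self_eq (by positivity) (by positivity)]
  simp only [auxPhi]
  field_simp
  linear_combination sin_sq_add_cos_sq p.1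

lemma auxPhi_n2 {L : ℝ} (hL : 0 < L) {p : ℝ × ℝ} (hp : p ∈ auxTri) :
    √((L - (auxPhi L p).1) ^ 2 + (auxPhi L p).2 ^ 2) = L * sin p.1 / sin (p.1 + p.2) := by
  obtain ⟨h1, h2, h3⟩ := auxTri_sin hp
  rw [Real.sqrt_eq_iff_mul_self_eq (by positivity) (by positivity), auxPhi_sub hp]
  simp only [auxPhi]
  field_simp
  linear_combination sin_sq_add_cos_sq p.2

lemma auxPsi_Phi {L : ℝ} (hL : 0 < L) {p : ℝ × ℝ} (hp : p ∈ auxTri) :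
    auxPsi L (auxPhi L p) = p := by
  obtain ⟨h1, h2, h3⟩ := auxTri_sin hp
  have a1 : (auxPhi L p).1 / √((auxPhi L p).1 ^ 2 + (auxPhi L p).2 ^ 2) = cos p.1 := by
    rw [auxPhi_n1 hL hp]; simp only [auxPhi]; field_simp
  have a2 : (L - (auxPhi L p).1) / √((L - (auxPhi L p).1) ^ 2 + (auxPhi L p).2 ^ 2) = cos p.2 := by
    rw [auxPhi_n2 hL hp, auxPhi_sub hp]; field_simp
  obtain ⟨g1, g2, g3⟩ := hp
  unfold auxPsi
  rw [a1, a2, arccos_cos g1.le (by linarith), arccos_cos g2.le (by linarith)]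

lemma aux_arccos {x r : ℝ} (hr : 0 < r) :
    0 < √(x ^ 2 + r ^ 2) ∧ 0 < arccos (x / √(x ^ 2 + r ^ 2)) ∧ arccos (x / √(x ^ 2 + r ^ 2)) < π ∧
    cos (arccos (x / √(x ^ 2 + r ^ 2))) = x / √(x ^ 2 + r ^ 2) ∧
    sin (arccos (x / √(x ^ 2 + r ^ 2))) = r / √(x ^ 2 + r ^ 2) := by
  have h0 : 0 < √(x ^ 2 + r ^ 2) := by positivity
  have hsq : √(x ^ 2 + r ^ 2) ^ 2 = x ^ 2 + r ^ 2 := Real.sq_sqrt (by positivity)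
  have hlt : |x| < √(x ^ 2 + r ^ 2) := by
    apply Real.lt_sqrt_of_sq_lt; rw [sq_abs]; nlinarith
  obtain ⟨l1, l2⟩ := abs_lt.1 hlt
  have b1 : x / √(x ^ 2 + r ^ 2) < 1 := by rwa [div_lt_one h0]
  have b2 : -1 < x / √(x ^ 2 + r ^ 2) := by rw [lt_div_iff₀ h0]; linarith
  refine ⟨h0, arccos_pos.2 b1, ?_, cos_arccos b2.le b1.le, ?_⟩
  · exact lt_of_le_of_ne (arccos_le_pi _) (fun h => by rw [arccos_eq_pi] at h; linarith)
  · rw [sin_arccos, Real.sqrt_eq_iff_mul_self_eq (by nlinarith) (by positivity)]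
    field_simp
    rw [hsq]; ring

lemma auxPsi_mem {L : ℝ} (hL : 0 < L) {q : ℝ × ℝ} (hq : 0 < q.2) :
    auxPsi L q ∈ auxTri ∧ auxPhi L (auxPsi L q) = q := by
  obtain ⟨a0, a1, a2, a3, a4⟩ := aux_arccos (x := q.1) hq
  obtain ⟨b0, b1, b2, b3, b4⟩ := aux_arccos (x := L - q.1) hq
  have hs : sin ((auxPsi L q).1 + (auxPsi L q).2) =
      L * q.2 / (√(q.1 ^ 2 + q.2 ^ 2) * √((L - q.1) ^ 2 + q.2 ^ 2)) := by
    simp only [auxPsi]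
    rw [sin_add, a3, a4, b3, b4]; field_simp; ring
  have hpos : 0 < sin ((auxPsi L q).1 + (auxPsi L q).2) := by rw [hs]; positivity
  refine ⟨⟨a1, b1, ?_⟩, ?_⟩
  · by_contra h
    push Not at h
    have : sin ((auxPsi L q).1 + (auxPsi L q).2 - π) < 0 := by rw [sin_sub_pi]; linarith
    have h2 : (auxPsi L q).1 + (auxPsi L q).2 - π ≤ π := by
      simp only [auxPsi]; linarith
    linarith [sin_nonneg_of_nonneg_of_le_pi (by linarith) h2]
  · unfold auxPhi
    rw [hs]
    simp only [auxPsi]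
    rw [a3, a4, b4]
    ext <;> simp <;> field_simp

lemma auxPhi_image {L : ℝ} (hL : 0 < L) : auxPhi L '' auxTri = univ ×ˢ Ioi (0:ℝ) := by
  ext q
  constructor
  · rintro ⟨p, hp, rfl⟩
    obtain ⟨h1, h2, h3⟩ := auxTri_sin hp
    refine ⟨mem_univ _, ?_⟩
    simp only [auxPhi, mem_Ioi]; positivity
  · rintro ⟨-, hq⟩
    exact ⟨_, (auxPsi_mem hL hq).1, (auxPsi_mem hL hq).2⟩

noncomputable def auxDPhi (L : ℝ) (p : ℝ × ℝ) : ℝ × ℝ →L[ℝ] ℝ × ℝ :=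
  (Matrix.toLin (.finTwoProd ℝ) (.finTwoProd ℝ)
    !![-(L * (sin p.2 * cos p.2)) / sin (p.1 + p.2) ^ 2, L * (cos p.1 * sin p.1) / sin (p.1 + p.2) ^ 2;
       L * sin p.2 ^ 2 / sin (p.1 + p.2) ^ 2, L * sin p.1 ^ 2 / sin (p.1 + p.2) ^ 2]).toContinuousLinearMap

lemma auxDPhi_det {L : ℝ} {p : ℝ × ℝ} (hp : p ∈ auxTri) :
    (auxDPhi L p).det = - (L ^ 2 * (sin p.1 * sin p.2) / sin (p.1 + p.2) ^ 3) := by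
  obtain ⟨h1, h2, h3⟩ := auxTri_sin hp
  unfold auxDPhi
  simp only [LinearMap.det_toContinuousLinearMap, LinearMap.det_toLin, Matrix.det_fin_two_of]
  field_simp
  rw [sin_add]; ring

lemma auxPhi_hasFDerivAt {L : ℝ} {p : ℝ × ℝ} (hp : p ∈ auxTri) :
    HasFDerivAt (auxPhi L) (auxDPhi L p) p := by
  obtain ⟨h1, h2, h3⟩ := auxTri_sin hp
  have c1 : HasFDerivAt (fun p : ℝ × ℝ => cos p.1) _ p := (hasDerivAt_cos p.1).comp_hasFDerivAt p (hasFDerivAt_fst (𝕜 := ℝ))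
  have s1 : HasFDerivAt (fun p : ℝ × ℝ => sin p.1) _ p := (hasDerivAt_sin p.1).comp_hasFDerivAt p (hasFDerivAt_fst (𝕜 := ℝ))
  have s2 : HasFDerivAt (fun p : ℝ × ℝ => sin p.2) _ p := (hasDerivAt_sin p.2).comp_hasFDerivAt p (hasFDerivAt_snd (𝕜 := ℝ))
  have s3 : HasFDerivAt (fun p : ℝ × ℝ => sin (p.1 + p.2)) _ p :=
    HasDerivAt.comp_hasFDerivAt (f := fun p : ℝ × ℝ => p.1 + p.2) p
      (hasDerivAt_sin (p.1 + p.2))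
      ((hasFDerivAt_fst (𝕜 := ℝ) (p := p)).add hasFDerivAt_snd)
  have i3 : HasFDerivAt (fun p : ℝ × ℝ => (sin (p.1 + p.2))⁻¹) _ p :=
    (hasDerivAt_inv h3.ne').comp_hasFDerivAt p s3
  have := HasFDerivAt.prodMk (((c1.mul s2).const_mul L).mul i3) (((s1.mul s2).const_mul L).mul i3)
  unfold auxDPhi
  rw [Matrix.toLin_finTwoProd_toContinuousLinearMap]
  convert! this using 1
  ext <;> simp <;> field_simp <;> rw [sin_add, cos_add]
  · linear_combination (L * cos p.2) * sin_sq_add_cos_sq p.1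
  · linear_combination (-L * sin p.2) * sin_sq_add_cos_sq p.1
  · linear_combination (-L * cos p.1 * sin p.1) * sin_sq_add_cos_sq p.2
  · linear_combination (-L * sin p.1) * sin_sq_add_cos_sq p.2

lemma auxPhi_integral {L : ℝ} (hL : 0 < L) (g : ℝ × ℝ → ℝ) :
    ∫ q in univ ×ˢ Ioi (0:ℝ), g q =
      ∫ p in auxTri, (L ^ 2 * (sin p.1 * sin p.2) / sin (p.1 + p.2) ^ 3) * g (auxPhi L p) := by
  rw [← auxPhi_image hL, integral_image_eq_integral_abs_det_fderiv_smul volume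
    auxTri_open.measurableSet (fun p hp => (auxPhi_hasFDerivAt hp).hasFDerivWithinAt)
    (fun p hp q hq h => by rw [← auxPsi_Phi hL hp, h, auxPsi_Phi hL hq])]
  apply setIntegral_congr_fun auxTri_open.measurableSet
  intro p hp
  obtain ⟨h1, h2, h3⟩ := auxTri_sin hp
  simp only [smul_eq_mul]
  rw [auxDPhi_det hp, abs_neg, abs_of_pos (by positivity)]

lemma aux_tri_ae : (triangleSet : Set (ℝ × ℝ)) =ᵐ[volume] auxTri := by
  have h1 : ∀ᵐ p : ℝ × ℝ, p.1 ≠ 0 :=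
    Measure.quasiMeasurePreserving_fst.ae (Measure.ae_ne volume (0:ℝ))
  have h2 : ∀ᵐ p : ℝ × ℝ, p.2 ≠ 0 :=
    Measure.quasiMeasurePreserving_snd.ae (Measure.ae_ne volume (0:ℝ))
  have h3 : ∀ᵐ p : ℝ × ℝ, p.1 + p.2 ≠ π := by
    rw [ae_iff, Measure.volume_eq_prod, Measure.measure_prod_null
      (by simp only [ne_eq, not_not]; exact measurableSet_eq_fun (by fun_prop) (by fun_prop))]
    refine Filter.Eventually.of_forall fun x => ?_
    refine measure_mono_null (t := {π - x}) ?_ (by simp)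
    intro y hy
    simp at hy ⊢
    linarith
  filter_upwards [h1, h2, h3] with p a b c
  apply propext
  constructor
  · rintro ⟨h1, h2, h3⟩
    exact ⟨lt_of_le_of_ne h1 a.symm, lt_of_le_of_ne h2 b.symm, lt_of_le_of_ne h3 c⟩
  · rintro ⟨h1, h2, h3⟩
    exact ⟨h1.le, h2.le, h3.le⟩

lemma aux_pow (n : ℕ) (γ L s t w : ℝ) (hL : 0 < L) (hs : 0 < s) (ht : 0 < t) (hw : 0 < w) :
    (L ^ 2 * (s * t) / w ^ 3) * ((L * (s * t) / w) ^ n *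
      ((L * t / w) ^ (2*γ - ((n + 2 : ℕ) : ℝ) - 1) * (L * s / w) ^ (2*γ - ((n + 2 : ℕ) : ℝ) - 1)
        * L ^ (((n + 2 : ℕ) : ℝ) + 2 - 4*γ))) =
    (s * t) ^ (2*γ - 2) * w ^ (((n + 2 : ℕ) : ℝ) + 1 - 4*γ) := by
  obtain ⟨L, rfl⟩ : ∃ l, L = exp l := ⟨_, (exp_log hL).symm⟩
  obtain ⟨s, rfl⟩ : ∃ l, s = exp l := ⟨_, (exp_log hs).symm⟩
  obtain ⟨t, rfl⟩ : ∃ l, t = exp l := ⟨_, (exp_log ht).symm⟩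
  obtain ⟨w, rfl⟩ : ∃ l, w = exp l := ⟨_, (exp_log hw).symm⟩
  simp only [← exp_add, ← exp_sub, ← exp_nat_mul, ← exp_mul]
  congr 1
  push_cast
  ring

lemma aux_const (n : ℕ) (γ : ℝ) :
    ((n + 1 : ℕ) * (√π ^ (n + 1) / Real.Gamma ((n + 1 : ℕ) / 2 + 1))) * cdg (n + 2) γ =
      Cbar (n + 2) γ := by
  have hG : Real.Gamma (((n + 1 : ℕ) : ℝ) / 2 + 1) =
      ((n + 1 : ℕ) : ℝ) / 2 * Real.Gamma (((n + 1 : ℕ) : ℝ) / 2) :=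
    Real.Gamma_add_one (by positivity)
  have hG0 : Real.Gamma (((n + 1 : ℕ) : ℝ) / 2) ≠ 0 := (Real.Gamma_pos_of_pos (by positivity)).ne'
  have hn : ((n + 1 : ℕ) : ℝ) ≠ 0 := by positivity
  have hpi : π ^ (-((n + 2 : ℕ) : ℝ) / 2) = (√π ^ (n + 2))⁻¹ := by
    rw [neg_div, Real.rpow_neg pi_pos.le, Real.sqrt_eq_rpow, ← Real.rpow_natCast, ← Real.rpow_mul pi_pos.le]
    congr 2; ring
  have e1 : (((n + 2 : ℕ) : ℝ) + 1) / 2 - γ = (((n + 2 : ℕ) : ℝ) + 1 - 2 * γ) / 2 := by ring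
  have e2 : (((n + 2 : ℕ) : ℝ) - 1) / 2 = ((n + 1 : ℕ) : ℝ) / 2 := by push_cast; ring
  unfold cdg Cbar
  rw [hG, hpi, e1, e2]
  have hs : √π ≠ 0 := by positivity
  generalize Real.Gamma (((n + 1 : ℕ) : ℝ) / 2) = A at *
  generalize Real.Gamma ((((n + 2 : ℕ) : ℝ) + 1 - 2 * γ) / 2) = B at *
  generalize Real.Gamma ((((n + 2 : ℕ) : ℝ) + 2 - 4 * γ) / 2) = C at *
  generalize Real.Gamma ((2 * γ - 1) / 2) = D at *
  generalize Real.Gamma (2 * γ - 1) = F at *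
  generalize ((n + 1 : ℕ) : ℝ) = N at *
  rw [pow_succ √π (n+1)]
  field_simp

theorem stmt4 (d : ℕ) (hd : 2 ≤ d) (γ : ℝ)
    (hγ : γ ∈ Set.Ioo (1/2 : ℝ) (((d : ℝ) + 2)/4))
    (ξ : EuclideanSpace ℝ (Fin d)) (hξ : ξ ≠ 0)
    (k : ℝ → ℝ → ℝ) (hk : Measurable fun p : ℝ × ℝ => k p.1 p.2)
    (hbd : ∃ C : ℝ, ∀ x y, |k x y| ≤ C) :
    ∫ η, k (InnerProductGeometry.angle ξ η) (InnerProductGeometry.angle ξ (ξ - η))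
        * Hker d γ η ξ =
      Cbar d γ * ∫ p in triangleSet, k p.1 p.2
          * (Real.sin p.1 * Real.sin p.2) ^ (2*γ - 2)
          * (Real.sin (p.1 + p.2)) ^ ((d : ℝ) + 1 - 4*γ) := by
  obtain ⟨n, rfl⟩ : ∃ n, d = n + 2 := ⟨d - 2, by omega⟩
  obtain ⟨S, hSm, hS0, hS1, hS2, hS3⟩ := aux_decomp n (by simp) ξ hξ
  have hL : 0 < ‖ξ‖ := by simpa using hξ
  set L := ‖ξ‖ with hLdef
  let a : ℝ := 2*γ - ((n + 2 : ℕ) : ℝ) - 1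
  let G : ℝ × ℝ → ℝ := fun q => k (auxPsi L q).1 (auxPsi L q).2 *
    (cdg (n + 2) γ * √(q.1 ^ 2 + q.2 ^ 2) ^ a * √((L - q.1) ^ 2 + q.2 ^ 2) ^ a
      * L ^ (((n + 2 : ℕ) : ℝ) + 2 - 4*γ))
  have hPsi : Measurable (auxPsi L) := by
    unfold auxPsi
    fun_prop
  have hG : Measurable G := by
    refine (hk.comp hPsi).mul ?_
    fun_prop
  have hnorm : ∀ η, ‖η‖ = √((S η).1 ^ 2 + (S η).2 ^ 2) := fun η => by
    rw [← hS2, Real.sqrt_sq (norm_nonneg _)]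
  have hnorm2 : ∀ η, ‖ξ - η‖ = √((L - (S η).1) ^ 2 + (S η).2 ^ 2) := fun η => by
    rw [← Real.sqrt_sq (norm_nonneg (ξ - η)), norm_sub_sq_real, hS1, hS2 η, ← hLdef]
    congr 1; ring
  have hcongr : ∀ η, k (InnerProductGeometry.angle ξ η) (InnerProductGeometry.angle ξ (ξ - η))
        * Hker (n + 2) γ η ξ = G (S η) := by
    intro η
    have h1 : InnerProductGeometry.angle ξ η = (auxPsi L (S η)).1 := by
      unfold InnerProductGeometry.angle auxPsi
      rw [hS1, ← hLdef, hnorm, mul_div_mul_left _ _ hL.ne']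
    have h2 : InnerProductGeometry.angle ξ (ξ - η) = (auxPsi L (S η)).2 := by
      unfold InnerProductGeometry.angle auxPsi
      rw [inner_sub_right, hS1 η, real_inner_self_eq_norm_sq, ← hLdef, hnorm2, sq, ← mul_sub,
        mul_div_mul_left _ _ hL.ne']
    rw [h1, h2]
    unfold Hker
    rw [hnorm2, hnorm]
  simp_rw [hcongr]
  rw [← integral_map hSm.aemeasurable hG.aestronglyMeasurable, hS3, integral_smul_measure,
    integral_withDensity_eq_integral_toReal_smul (by fun_prop) (by simp),
    ENNReal.toReal_ofReal (by positivity), auxPhi_integral hL, setIntegral_congr_set aux_tri_ae,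
    ← aux_const, smul_eq_mul, mul_assoc _ (cdg (n + 2) γ), ← integral_const_mul (cdg (n + 2) γ)]
  congr 1
  apply setIntegral_congr_fun auxTri_open.measurableSet
  intro p hp
  obtain ⟨h1, h2, h3⟩ := auxTri_sin hp
  have hpow := aux_pow n γ L _ _ _ hL h1 h2 h3
  simp only [G, smul_eq_mul]
  rw [auxPsi_Phi hL hp, auxPhi_n1 hL hp, auxPhi_n2 hL hp, ENNReal.toReal_ofReal
    (by simp only [auxPhi]; positivity)]
  simp only [auxPhi, a]
  rw [mul_assoc (k p.1 p.2), ← hpow]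
  ring
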